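/- Let (G, P_G) be a preordered group and M_G the (normal) subgroup of G generated by P_G ∪ (-P_G). Then (G, M_G) satisfies the universal property of the reflection into protomodular preordered groups: for any group H with a conjugation-closed subGROUP P_H ⊆ H (i.e., P_H is a subgroup) and any group homomorphism f : G → H with f(P_G) ⊆ P_H, we have f(M_G) ⊆ P_H, and f is the unique homomorphism (G, M_G) → (H, P_H) extending f along the identity of G. -/

import Mathlib

/-- Universal property of the reflection onto protomodular preordered
groups: for any group homomorphism `f : G → H` sending the cone `P_G` into a
conjugation-closed subgroup `Q ≤ H`, `f` maps the subgroup `M_G` generated by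
`P_G ∪ (-P_G)` into `Q`, and `f` is the unique such extension along `1_G`. -/
theorem stmt_15 (G H : Type*) [AddGroup G] [AddGroup H]
    (P : AddSubmonoid G)
    (hconjP : ∀ g : G, ∀ p ∈ P, g + p - g ∈ P)
    (Q : AddSubgroup H)
    (hconjQ : ∀ h : H, ∀ q ∈ Q, h + q - h ∈ Q)
    (f : G →+ H) (hcone : ∀ p ∈ P, f p ∈ Q) :
    (∀ m ∈ AddSubgroup.closure ((P : Set G) ∪ (-(P : Set G))), f m ∈ Q) ∧
    (∀ g : G →+ H, (∀ x : G, g x = f x) → g = f) := by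
  refine ⟨?_, fun g hg => DFunLike.ext g f hg⟩
  suffices h : AddSubgroup.closure ((P : Set G) ∪ (-(P : Set G))) ≤ Q.comap f from
    fun m hm => h hm
  rw [AddSubgroup.closure_le]
  rintro x (hx | hx)
  · exact hcone x hx
  · have hneg : f (-x) ∈ Q := hcone (-x) hx
    rw [map_neg] at hneg
    exact Q.neg_mem_iff.mp hneg
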